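/- For a, b ∈ ℝ, a positive integer k, and z in the upper half-plane ℍ, define the theta-constant θ(a,b;z)_k = ∑_{n∈ℤ} exp(kπi[(a+n)²z + 2b(a+n)]). Then for all z ∈ ℍ: θ(a,b;−1/z)_k = k^{−1/2}·(−iz)^{1/2}·e^{2kπiab}·∑_{s=0}^{k−1} θ(b + s/k, −a; z)_k. -/

import Mathlib

/-- The theta-constant `θ(a,b;z)_k = ∑_{n∈ℤ} exp(kπi[(a+n)²z + 2b(a+n)])`. -/
noncomputable def thetaConst (a b : ℝ) (k : ℕ) (z : ℂ) : ℂ :=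
  ∑' n : ℤ, Complex.exp ((k : ℂ) * (Real.pi : ℂ) * Complex.I *
    (((a : ℂ) + (n : ℂ)) ^ 2 * z + 2 * (b : ℂ) * ((a : ℂ) + (n : ℂ))))

open Complex in
/-- Completing the square expresses a theta-constant through Mathlib's Jacobi theta function. -/
lemma thetaConst_eq_jacobiTheta₂ (a b : ℝ) (k : ℕ) (z : ℂ) :
    thetaConst a b k z = cexp (k * Real.pi * I * (a ^ 2 * z + 2 * a * b)) *
      jacobiTheta₂ (k * (a * z + b)) (k * z) := by
  rw [thetaConst, jacobiTheta₂, ← tsum_mul_left]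
  refine tsum_congr fun n => ?_
  rw [jacobiTheta₂_term, ← exp_add]
  congr 1
  ring

/-- A summable series over `ℤ` splits into the sum over residue classes modulo `k`. -/
lemma Summable.tsum_int_eq_sum_residueClasses {f : ℤ → ℂ} (hf : Summable f)
    (k : ℕ) [NeZero k] :
    ∑' n : ℤ, f n = ∑ s ∈ Finset.range k, ∑' m : ℤ, f (m * k + s) := by
  have hs : Summable fun p : Fin k × ℤ => f (p.2 * k + (p.1 : ℕ)) :=
    ((Equiv.prodComm (Fin k) ℤ).trans (Int.divModEquiv k).symm).summable_iff.mpr hf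
  rw [Finset.sum_range, ← ((Equiv.prodComm (Fin k) ℤ).trans (Int.divModEquiv k).symm).tsum_eq f,
    ← tsum_fintype (L := .unconditional _)]
  exact hs.tsum_prod

open Complex in
/-- Splitting the Jacobi theta series by residues modulo `k` produces theta-constants. -/
lemma exp_mul_jacobiTheta₂_eq_sum_thetaConst (a b : ℝ) {k : ℕ} (hk : 0 < k) {z : ℂ}
    (hz : 0 < z.im) :
    cexp (k * Real.pi * I * (b ^ 2 * z)) * jacobiTheta₂ (b * z - a) (z / k) =
      cexp (2 * k * Real.pi * I * a * b) *
        ∑ s ∈ Finset.range k, thetaConst (b + (s : ℝ) / (k : ℝ)) (-a) k z := by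
  have : NeZero k := ⟨hk.ne'⟩
  have hk0 : (k : ℂ) ≠ 0 := Nat.cast_ne_zero.mpr hk.ne'
  have him : 0 < (z / k).im := by
    rw [div_natCast_im]
    positivity
  rw [jacobiTheta₂, ((summable_jacobiTheta₂_term_iff (b * z - a) _).mpr
    him).tsum_int_eq_sum_residueClasses k, Finset.mul_sum, Finset.mul_sum]
  refine Finset.sum_congr rfl fun s _ => ?_
  rw [thetaConst, ← tsum_mul_left, ← tsum_mul_left]
  refine tsum_congr fun m => ?_
  rw [jacobiTheta₂_term, ← exp_add, ← exp_add]
  congr 1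
  push_cast
  field_simp
  ring

open Complex in
lemma Complex.div_natCast_cpow {k : ℕ} (hk : 0 < k) {x : ℂ} (hx : x ≠ 0) (r : ℂ) :
    (x / k) ^ r = (k : ℂ) ^ (-r) * x ^ r := by
  have hk0 : (k : ℂ) ≠ 0 := Nat.cast_ne_zero.mpr hk.ne'
  have hlog : log (x / k) = log x - log k := by
    have h := log_ofReal_mul (r := (k : ℝ)⁻¹) (by positivity) hx
    rw [Real.log_inv] at h
    push_cast at h
    rw [div_eq_inv_mul, h]
    ring
  rw [cpow_def_of_ne_zero (div_ne_zero hx hk0), cpow_def_of_ne_zero hk0,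
    cpow_def_of_ne_zero hx, hlog, ← exp_add]
  congr 1
  ring

/-- the transformation formula
`θ(a,b;−1/z)_k = k^{−1/2}(−iz)^{1/2} e^{2kπiab} ∑_{s=0}^{k−1} θ(b+s/k,−a;z)_k`. -/
theorem thetaConst_inversion (a b : ℝ) (k : ℕ) (hk : 0 < k)
    (z : ℂ) (hz : 0 < z.im) :
    thetaConst a b k (-1 / z) =
      (k : ℂ) ^ (-(1 / 2 : ℂ)) * (-Complex.I * z) ^ (1 / 2 : ℂ) *
        Complex.exp (2 * (k : ℂ) * (Real.pi : ℂ) * Complex.I * (a : ℂ) * (b : ℂ)) *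
        ∑ s ∈ Finset.range k, thetaConst (b + (s : ℝ) / (k : ℝ)) (-a) k z := by
  have hz0 : z ≠ 0 := by
    rintro rfl
    simp at hz
  have hk0 : (k : ℂ) ≠ 0 := Nat.cast_ne_zero.mpr hk.ne'
  have hIz : -Complex.I * z ≠ 0 := mul_ne_zero (neg_ne_zero.mpr Complex.I_ne_zero) hz0
  have hroot : (-Complex.I * (z / k)) ^ (1 / 2 : ℂ) ≠ 0 := by
    rw [← mul_div_assoc, Complex.cpow_ne_zero_iff]
    exact Or.inl (div_ne_zero hIz hk0)
  have hfe := jacobiTheta₂_functional_equation (b * z - a) (z / k)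
  have h1 : ((b : ℂ) * z - a) / (z / k) = k * (a * (-1 / z) + b) := by
    field_simp
    ring
  have h2 : -1 / (z / k) = k * (-1 / z) := by
    field_simp
  rw [h1, h2] at hfe
  have hexp : Complex.exp (k * Real.pi * Complex.I * (b ^ 2 * z)) *
      Complex.exp (-Real.pi * Complex.I * (b * z - a) ^ 2 / (z / k)) =
      Complex.exp (k * Real.pi * Complex.I * (a ^ 2 * (-1 / z) + 2 * a * b)) := by
    rw [← Complex.exp_add]
    congr 1
    field_simp
    ring
  rw [mul_assoc, ← exp_mul_jacobiTheta₂_eq_sum_thetaConst a b hk hz,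
    ← Complex.div_natCast_cpow hk hIz, mul_div_assoc, hfe, thetaConst_eq_jacobiTheta₂, ← hexp]
  generalize (-Complex.I * (z / k)) ^ (1 / 2 : ℂ) = w at hroot ⊢
  generalize jacobiTheta₂ _ _ = ϑ
  field_simp
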